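/- Let E be a real inner product space and F : E → ℝ differentiable with L-Lipschitz gradient, where L > 0. For any x, e, Δ ∈ E, set x⁺ = x + Δ − (1/L)·(∇F(x) − e). Then F(x⁺) ≤ F(x) − (1/(2L))·‖∇F(x)‖² + (1/(2L))·‖e + L·Δ‖². -/

import Mathlib

lemma descent_aux
    {E : Type*} [NormedAddCommGroup E] [InnerProductSpace ℝ E]
    (F : E → ℝ) (F' : E → E)
    (hF : ∀ x, HasFDerivAt F (innerSL ℝ (F' x)) x)
    (L : ℝ)
    (hLip : ∀ x y, ‖F' x - F' y‖ ≤ L * ‖x - y‖)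
    (x d : E) :
    F (x + d) ≤ F x + inner ℝ (F' x) d + L / 2 * ‖d‖ ^ 2 := by
  have hder : ∀ t : ℝ, HasDerivAt
      (fun t : ℝ => F (x + t • d) - t * inner ℝ (F' x) d - t ^ 2 * (L / 2 * ‖d‖ ^ 2))
      (inner ℝ (F' (x + t • d)) d - inner ℝ (F' x) d - 2 * t * (L / 2 * ‖d‖ ^ 2)) t := by
    intro t
    have h1 : HasDerivAt (fun t : ℝ => x + t • d) d t := by
      simpa using ((hasDerivAt_id t).smul_const d).const_add x
    have h2 : HasDerivAt (fun t : ℝ => F (x + t • d)) (inner ℝ (F' (x + t • d)) d) t := by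
      exact (hF (x + t • d)).comp_hasDerivAt t h1
    have h3 : HasDerivAt (fun t : ℝ => t * inner ℝ (F' x) d) (inner ℝ (F' x) d) t := by
      simpa using (hasDerivAt_id t).mul_const (inner ℝ (F' x) d)
    have h4 : HasDerivAt (fun t : ℝ => t ^ 2 * (L / 2 * ‖d‖ ^ 2))
        (2 * t * (L / 2 * ‖d‖ ^ 2)) t := by
      simpa using (hasDerivAt_pow 2 t).mul_const (L / 2 * ‖d‖ ^ 2)
    exact (h2.sub h3).sub h4
  have hanti := antitoneOn_of_deriv_nonpos (convex_Icc (0 : ℝ) 1)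
    (fun t _ => (hder t).continuousAt.continuousWithinAt)
    (fun t _ => (hder t).differentiableAt.differentiableWithinAt)
    (by
      intro t ht
      rw [interior_Icc] at ht
      rw [(hder t).deriv]
      have h1 := real_inner_le_norm (F' (x + t • d) - F' x) d
      rw [inner_sub_left] at h1
      have h2 := hLip (x + t • d) x
      rw [add_sub_cancel_left, norm_smul, Real.norm_of_nonneg ht.1.le] at h2
      nlinarith [mul_le_mul_of_nonneg_right h2 (norm_nonneg d)])
  have := hanti (Set.left_mem_Icc.2 zero_le_one) (Set.right_mem_Icc.2 zero_le_one) zero_le_one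
  simp at this
  linarith

/-- **Perturbed gradient-step bound (equation (40) of Appendix B).** If `F : E → ℝ` is
differentiable on a real inner product space with gradient `F'` that is `L`-Lipschitz
(`L > 0`), then for any `x, e, Δ ∈ E`, setting `x⁺ = x + Δ - (1/L)(∇F(x) - e)` we have
`F x⁺ ≤ F x - (1/(2L)) ‖∇F(x)‖² + (1/(2L)) ‖e + L Δ‖²`. -/
theorem perturbed_gradient_step_bound
    {E : Type*} [NormedAddCommGroup E] [InnerProductSpace ℝ E]
    (F : E → ℝ) (F' : E → E)
    (hF : ∀ x, HasFDerivAt F (innerSL ℝ (F' x)) x)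
    (L : ℝ) (hL : 0 < L)
    (hLip : ∀ x y, ‖F' x - F' y‖ ≤ L * ‖x - y‖)
    (x e Δ : E) :
    F (x + Δ - (1 / L) • (F' x - e)) ≤
      F x - 1 / (2 * L) * ‖F' x‖ ^ 2 + 1 / (2 * L) * ‖e + L • Δ‖ ^ 2 := by
  have h := descent_aux F F' hF L hLip x ((1 / L) • (e + L • Δ - F' x))
  have hx : x + Δ - (1 / L) • (F' x - e) = x + (1 / L) • (e + L • Δ - F' x) := by
    have : (1 / L) • (L • Δ) = Δ := by
      rw [smul_smul, one_div_mul_cancel hL.ne', one_smul]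
    rw [smul_sub, smul_sub, smul_add, this]
    abel
  rw [hx]
  refine h.trans (le_of_eq ?_)
  rw [norm_smul, mul_pow, norm_sub_sq_real, inner_smul_right, inner_sub_right,
    real_inner_self_eq_norm_sq, real_inner_comm (F' x) (e + L • Δ), Real.norm_eq_abs, sq_abs]
  field_simp
  ring
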